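/- Dissipative Bell-state preparation: with the 2-system-qubit, 2-ancilla network defined in the context, let ρ₀ := |ψ₀⟩⟨ψ₀| ⊗ |(true,true)⟩⟨(true,true)| with ψ₀ := (1/2)·Σ_{s ∈ Bool × Bool} |s⟩, and let P := I ⊗ |(true,true)⟩⟨(true,true)| be the projection onto both ancillas being in state |1⟩. Then as t → ∞, the partial trace over the two ancillas of P · E_t(ρ₀) · P converges to (1/2)·|ψ⁺⟩⟨ψ⁺|, where ψ⁺ := (|(false,false)⟩ + |(true,true)⟩)/√2 is the maximally entangled Bell state (so post-selection on ancilla outcome (1,1) succeeds with probability 1/2 and prepares |ψ⁺⟩). -/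

import Mathlib

open Matrix Filter
open scoped Kronecker Topology

attribute [local instance] Matrix.normedAddCommGroup Matrix.normedSpace

noncomputable section

/-- Index type of the two system qubits. -/
abbrev Sys := Bool × Bool

/-- Index type of the two ancilla qubits. -/
abbrev Anc := Bool × Bool

/-- The Lindblad operator `L₁ = |01⟩⟨01| ⊗ σ⁻` on the first ancilla. -/
def L₁ : Matrix (Sys × Anc) (Sys × Anc) ℂ :=
  Matrix.of fun p q =>
    if p.1 = (false, true) ∧ q.1 = (false, true) ∧ p.2.2 = q.2.2 ∧
        p.2.1 = false ∧ q.2.1 = true then 1 else 0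

/-- The Lindblad operator `L₂ = |10⟩⟨10| ⊗ σ⁻` on the second ancilla. -/
def L₂ : Matrix (Sys × Anc) (Sys × Anc) ℂ :=
  Matrix.of fun p q =>
    if p.1 = (true, false) ∧ q.1 = (true, false) ∧ p.2.1 = q.2.1 ∧
        p.2.2 = false ∧ q.2.2 = true then 1 else 0

/-- The Lindbladian `ℒ(ρ) = γ (L ρ L† − (1/2)(L†L ρ + ρ L†L))` as a linear endomorphism
of the matrix space. -/
def lindbladian {d : Type*} [Fintype d] [DecidableEq d] (γ : ℝ) (L : Matrix d d ℂ) :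
    Matrix d d ℂ →ₗ[ℂ] Matrix d d ℂ :=
  (γ : ℂ) • ((LinearMap.mulRight ℂ Lᴴ).comp (LinearMap.mulLeft ℂ L)
    - (1 / 2 : ℂ) • (LinearMap.mulLeft ℂ (Lᴴ * L) + LinearMap.mulRight ℂ (Lᴴ * L)))

/-- The evolution `E_t = exp(t·ℒ)`. -/
def evol {d : Type*} [Fintype d] [DecidableEq d]
    (L : Matrix d d ℂ →ₗ[ℂ] Matrix d d ℂ) (t : ℝ) :
    Matrix d d ℂ →L[ℂ] Matrix d d ℂ :=
  haveI : IsTopologicalRing (Matrix d d ℂ →L[ℂ] Matrix d d ℂ) :=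
    inferInstanceAs (IsTopologicalRing (@ContinuousLinearMap ℂ ℂ _ _ (RingHom.id ℂ)
      (Matrix d d ℂ) (Matrix.normedAddCommGroup).toUniformSpace.toTopologicalSpace _
      (Matrix d d ℂ) (Matrix.normedAddCommGroup).toUniformSpace.toTopologicalSpace _ _ _))
  NormedSpace.exp ((t : ℂ) • LinearMap.toContinuousLinearMap L)

/-- The initial product state `|ψ₀⟩ = |+,+⟩` of the two system qubits. -/
def ψ₀ : Sys → ℂ := fun _ => 1 / 2

/-- The maximally entangled Bell state `|ψ⁺⟩ = (|00⟩ + |11⟩)/√2`. -/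
def ψplus : Sys → ℂ := fun s => if s.1 = s.2 then ((Real.sqrt 2 : ℝ) : ℂ)⁻¹ else 0

/-- The projection `P = I ⊗ |(1,1)⟩⟨(1,1)|` onto both ancillas in state `|1⟩`. -/
def Pproj : Matrix (Sys × Anc) (Sys × Anc) ℂ :=
  (1 : Matrix Sys Sys ℂ) ⊗ₖ Matrix.single (true, true) (true, true) (1 : ℂ)

/-- Partial trace over the two ancillas: `(s,s') ↦ Σ_a M((s,a),(s',a))`. -/
def ptraceAnc (M : Matrix (Sys × Anc) (Sys × Anc) ℂ) : Matrix Sys Sys ℂ :=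
  Matrix.of fun s s' => ∑ a : Anc, M (s, a) (s', a)

theorem exp_left_eigen {E : Type*} [NormedAddCommGroup E] [NormedSpace ℂ E] [CompleteSpace E]
    (A : E →L[ℂ] E) (f : E →L[ℂ] ℂ) (c : ℂ) (hf : ∀ x, f (A x) = c * f x) (x : E) :
    f (NormedSpace.exp A x) = Complex.exp c * f x := by
  have hpow : ∀ n : ℕ, ∀ y, f ((A ^ n) y) = c ^ n * f y := by
    intro n
    induction n with
    | zero => intro y; simp
    | succ k ih =>
      intro y
      rw [pow_succ, ContinuousLinearMap.mul_apply, ih, hf]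
      ring
  have h1 := NormedSpace.exp_series_hasSum_exp' (𝕂 := ℂ) A
  have h2 := (f.comp (ContinuousLinearMap.apply ℂ E x)).hasSum h1
  have h3 := (NormedSpace.exp_series_hasSum_exp' (𝕂 := ℂ) c).mul_right (f x)
  rw [← Complex.exp_eq_exp_ℂ] at h3
  refine HasSum.unique h2 ?_
  have hfun : (fun n : ℕ => ((n.factorial : ℂ)⁻¹ • c ^ n) * f x) =
      fun n : ℕ => (f.comp (ContinuousLinearMap.apply ℂ E x))
        ((n.factorial : ℂ)⁻¹ • A ^ n) := by
    funext n
    rw [map_smul, smul_mul_assoc, ← hpow]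
    rfl
  rw [← hfun]
  exact h3

/-- The decay weight of the basis state `s`. -/
def decayW (s : Sys) : ℂ := if s.1 = s.2 then 0 else 1

/-- Matrix entry as a linear functional. -/
def entryL (p q : Sys × Anc) : Matrix (Sys × Anc) (Sys × Anc) ℂ →ₗ[ℂ] ℂ :=
  Matrix.entryLinearMap ℂ ℂ p q

theorem gram₁ : L₁ᴴ * L₁ = Matrix.diagonal fun p : Sys × Anc =>
    if p.1 = (false, true) ∧ p.2.1 = true then (1 : ℂ) else 0 := by
  ext ⟨⟨a, b⟩, c, d⟩ ⟨⟨a', b'⟩, c', d'⟩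
  simp only [Matrix.mul_apply, Matrix.conjTranspose_apply, Fintype.sum_prod_type,
    Fintype.sum_bool, L₁, Matrix.of_apply, Matrix.diagonal_apply]
  cases a <;> cases b <;> cases c <;> cases d <;> simp <;> grind

theorem gram₂ : L₂ᴴ * L₂ = Matrix.diagonal fun p : Sys × Anc =>
    if p.1 = (true, false) ∧ p.2.2 = true then (1 : ℂ) else 0 := by
  ext ⟨⟨a, b⟩, c, d⟩ ⟨⟨a', b'⟩, c', d'⟩
  simp only [Matrix.mul_apply, Matrix.conjTranspose_apply, Fintype.sum_prod_type,
    Fintype.sum_bool, L₂, Matrix.of_apply, Matrix.diagonal_apply]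
  cases a <;> cases b <;> cases c <;> cases d <;> simp <;> grind

theorem jump₁ (M : Matrix (Sys × Anc) (Sys × Anc) ℂ) (s : Sys) (q : Sys × Anc) :
    (L₁ * M) (s, (true, true)) q = 0 := by
  simp [Matrix.mul_apply, L₁]

theorem jump₂ (M : Matrix (Sys × Anc) (Sys × Anc) ℂ) (s : Sys) (q : Sys × Anc) :
    (L₂ * M) (s, (true, true)) q = 0 := by
  simp [Matrix.mul_apply, L₂]

theorem entry_lindblad (γ : ℝ) (s s' : Sys) (M : Matrix (Sys × Anc) (Sys × Anc) ℂ) :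
    (lindbladian γ L₁ + lindbladian γ L₂) M (s, (true, true)) (s', (true, true))
      = (-(γ / 2) * (decayW s + decayW s')) * M (s, (true, true)) (s', (true, true)) := by
  simp only [lindbladian, gram₁, gram₂, LinearMap.add_apply, LinearMap.smul_apply,
    LinearMap.sub_apply, LinearMap.comp_apply, LinearMap.mulLeft_apply, LinearMap.mulRight_apply,
    Matrix.add_apply, Matrix.smul_apply, Matrix.sub_apply, Matrix.mul_assoc, jump₁, jump₂,
    Matrix.diagonal_mul, Matrix.mul_diagonal, smul_eq_mul]
  obtain ⟨a, b⟩ := s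
  obtain ⟨a', b'⟩ := s'
  cases a <;> cases b <;> cases a' <;> cases b' <;> simp [decayW] <;> ring

theorem evol_entry (γ t : ℝ) (s s' : Sys) (M : Matrix (Sys × Anc) (Sys × Anc) ℂ) :
    evol (lindbladian γ L₁ + lindbladian γ L₂) t M (s, (true, true)) (s', (true, true))
      = Complex.exp (t * (-(γ / 2) * (decayW s + decayW s')))
        * M (s, (true, true)) (s', (true, true)) := by
  refine exp_left_eigen ((t : ℂ) • LinearMap.toContinuousLinearMap
      (lindbladian γ L₁ + lindbladian γ L₂))
    (LinearMap.toContinuousLinearMap (entryL (s, (true, true)) (s', (true, true))))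
    (t * (-(γ / 2) * (decayW s + decayW s'))) ?_ M
  intro X
  have := entry_lindblad γ s s' X
  change (t : ℂ) * ((lindbladian γ L₁ + lindbladian γ L₂) X (s, (true, true)) (s', (true, true)))
    = _ * X (s, (true, true)) (s', (true, true))
  rw [this]
  ring

theorem ptrace_proj (M : Matrix (Sys × Anc) (Sys × Anc) ℂ) (s s' : Sys) :
    ptraceAnc (Pproj * M * Pproj) s s' = M (s, (true, true)) (s', (true, true)) := by
  have hP : Pproj = Matrix.diagonal fun p : Sys × Anc =>
      if p.2 = (true, true) then (1 : ℂ) else 0 := by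
    ext ⟨a, b⟩ ⟨a', b'⟩
    simp only [Pproj, Matrix.kroneckerMap_apply, Matrix.one_apply, Matrix.single_apply,
      Matrix.diagonal_apply, Prod.mk.injEq]
    grind
  simp [hP, ptraceAnc, Matrix.diagonal_mul, Matrix.mul_diagonal]

theorem exp_decay (c : ℝ) (hc : 0 < c) (w : ℂ) :
    Tendsto (fun t : ℝ => Complex.exp (t * (-c : ℂ)) * w) atTop (𝓝 0) := by
  have h : Tendsto (fun t : ℝ => Real.exp (t * (-c))) atTop (𝓝 0) :=
    Real.tendsto_exp_atBot.comp (tendsto_id.atTop_mul_const_of_neg (by linarith))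
  have h2 := ((Complex.continuous_ofReal.tendsto 0).comp h).mul_const w
  simpa [Function.comp_def] using h2

/-- dissipative Bell-state preparation: post-selecting on ancilla
outcome `(1,1)` (success probability `1/2`), the system state converges as `t → ∞` to
the maximally entangled Bell state `|ψ⁺⟩⟨ψ⁺|`, i.e.
`Tr_anc(P E_t(ρ₀) P) → (1/2)·|ψ⁺⟩⟨ψ⁺|`. -/
theorem bell_state_preparation (γ : ℝ) (hγ : 0 < γ) :
    Tendsto
      (fun t : ℝ => ptraceAnc (Pproj *
        evol (lindbladian γ L₁ + lindbladian γ L₂) t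
          (Matrix.vecMulVec ψ₀ (star ψ₀) ⊗ₖ
            Matrix.single (true, true) (true, true) (1 : ℂ)) * Pproj))
      atTop
      (𝓝 ((1 / 2 : ℂ) • Matrix.vecMulVec ψplus (star ψplus))) := by
  have hs : ((Real.sqrt 2 : ℝ) : ℂ)⁻¹ * ((Real.sqrt 2 : ℝ) : ℂ)⁻¹ = 1 / 2 := by
    rw [← mul_inv, ← Complex.ofReal_mul, Real.mul_self_sqrt (by norm_num)]
    norm_num
  refine tendsto_pi_nhds.2 fun s => tendsto_pi_nhds.2 fun s' => ?_
  simp only [ptrace_proj, evol_entry]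
  have hlim : ((1 / 2 : ℂ) • Matrix.vecMulVec ψplus (star ψplus)) s s' =
      if s.1 = s.2 ∧ s'.1 = s'.2 then 1 / 4 else 0 := by
    simp only [Matrix.smul_apply, Matrix.vecMulVec_apply, ψplus, Pi.star_apply, smul_eq_mul]
    by_cases h : s.1 = s.2 <;> by_cases h' : s'.1 = s'.2 <;> simp [h, h']
    linear_combination (1 / 2 : ℂ) * hs
  have hρ : (Matrix.vecMulVec ψ₀ (star ψ₀) ⊗ₖ
      Matrix.single (true, true) (true, true) (1 : ℂ) : Matrix (Sys × Anc) (Sys × Anc) ℂ)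
        (s, (true, true)) (s', (true, true)) = 1 / 4 := by
    simp [Matrix.vecMulVec_apply, ψ₀]
    norm_num
  rw [hlim]
  simp only [hρ]
  by_cases h : s.1 = s.2 <;> by_cases h' : s'.1 = s'.2
  · simp only [decayW, h, h']
    norm_num
  · have := exp_decay (γ / 2) (by positivity) (1 / 4)
    simp only [decayW, h, h']
    norm_num at this ⊢
    exact this
  · have := exp_decay (γ / 2) (by positivity) (1 / 4)
    simp only [decayW, h, h']
    norm_num at this ⊢
    exact this
  · have := exp_decay γ (by positivity) (1 / 4)
    simp only [decayW, h, h']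
    norm_num at this ⊢
    exact this
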